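/- Assume X is integrable, X·exp(−η(X + λ)) is integrable, and 0 < P(R) < 1. Writing π = P(R), μ2 = E[X | Ω∖R] = E[X·1_{Ω∖R}]/(1 − π) and E[X·exp(−η(X+λ)) | R] = E[X·exp(−η(X+λ))·1_R]/π, the mean of the missing data satisfies μ2 = (π/(1 − π)) · E[X · exp(−η(X + λ)) | R]. -/

import Mathlib

open MeasureTheory

/-- `expit(t) = e^t / (1 + e^t)`. -/
noncomputable def expit (t : ℝ) : ℝ := Real.exp t / (1 + Real.exp t)

lemma expit_mul_exp_neg (t : ℝ) : Real.exp (-t) * expit t = 1 - expit t := by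
  have h : 1 + Real.exp t ≠ 0 := by positivity
  rw [expit, Real.exp_neg]
  field_simp
  ring

/-- Inside an integral, the indicator of an event may be replaced by its conditional expectation
given a σ-algebra for which the other factor is measurable. -/
lemma integral_mul_indicator_eq_integral_mul_condExp {Ω : Type*} {m F : MeasurableSpace Ω}
    {μ : Measure Ω} [IsFiniteMeasure μ] (hm : m ≤ F) {f : Ω → ℝ} (hf : StronglyMeasurable[m] f)
    (hfint : Integrable f μ) {s : Set Ω} (hs : MeasurableSet s) :
    ∫ ω, f ω * s.indicator (fun _ => (1 : ℝ)) ω ∂μ =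
      ∫ ω, f ω * (μ[s.indicator (fun _ => (1 : ℝ)) | m]) ω ∂μ := by
  have hfs : Integrable (f * s.indicator fun _ => (1 : ℝ)) μ := by
    refine (hfint.indicator hs).congr (.of_forall fun ω => ?_)
    by_cases h : ω ∈ s <;> simp [h]
  have hsint : Integrable (s.indicator fun _ => (1 : ℝ)) μ := (integrable_const 1).indicator hs
  exact (integral_condExp hm (f := f * s.indicator fun _ => (1 : ℝ))).symm.trans
    (integral_congr_ae (condExp_mul_of_stronglyMeasurable_left hf hfs hsint))

/-- Under the logistic missing-data mechanism `P(R = 1 | X) = expit(η(X + λ))` with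
`0 < P(R) < 1`, the mean of the missing data satisfies
`μ₂ = (π/(1 − π)) · E[X · exp(−η(X + λ)) | R]` where `π = P(R)`. -/
theorem stmt8 {Ω : Type*} {F : MeasurableSpace Ω} (μ : Measure Ω) [IsProbabilityMeasure μ]
    (X : Ω → ℝ) (hX : Measurable X)
    (R : Set Ω) (hR : MeasurableSet R)
    (η lam : ℝ)
    (hmdm : μ[R.indicator (fun _ => (1 : ℝ)) | MeasurableSpace.comap X inferInstance]
      =ᵐ[μ] fun ω => expit (η * (X ω + lam)))
    (hXint : Integrable X μ)
    (hXtilt : Integrable (fun ω => X ω * Real.exp (-(η * (X ω + lam)))) μ)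
    (hR0 : 0 < (μ R).toReal) (hR1 : (μ R).toReal < 1) :
    (∫ ω, X ω * Rᶜ.indicator (fun _ => (1 : ℝ)) ω ∂μ) / (1 - (μ R).toReal) =
      ((μ R).toReal / (1 - (μ R).toReal)) *
        ((∫ ω, X ω * Real.exp (-(η * (X ω + lam))) * R.indicator (fun _ => (1 : ℝ)) ω ∂μ) /
          (μ R).toReal) := by
  have hm : MeasurableSpace.comap X inferInstance ≤ F := hX.comap_le
  have hXm : Measurable[MeasurableSpace.comap X inferInstance] X := comap_measurable X
  have hg : Measurable fun x : ℝ => x * Real.exp (-(η * (x + lam))) := by fun_prop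
  have htilt := integral_mul_indicator_eq_integral_mul_condExp hm
    (hg.comp hXm).stronglyMeasurable hXtilt hR
  have hobs := integral_mul_indicator_eq_integral_mul_condExp hm hXm.stronglyMeasurable hXint hR
  have hXR : Integrable (fun ω => X ω * R.indicator (fun _ => (1 : ℝ)) ω) μ := by
    refine (hXint.indicator hR).congr (.of_forall fun ω => ?_)
    by_cases h : ω ∈ R <;> simp [h]
  have hXp : Integrable
      (fun ω => X ω * (μ[R.indicator (fun _ => (1 : ℝ)) | MeasurableSpace.comap X inferInstance]) ω)
      μ :=
    (integrable_condExp (m := MeasurableSpace.comap X inferInstance)).congr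
      (condExp_mul_of_stronglyMeasurable_left hXm.stronglyMeasurable hXR
        ((integrable_const (1 : ℝ)).indicator hR))
  have key : ∫ ω, X ω * Rᶜ.indicator (fun _ => (1 : ℝ)) ω ∂μ =
      ∫ ω, X ω * Real.exp (-(η * (X ω + lam))) * R.indicator (fun _ => (1 : ℝ)) ω ∂μ := by
    calc
      _ = ∫ ω, X ω - X ω * R.indicator (fun _ => (1 : ℝ)) ω ∂μ := by
        refine integral_congr_ae (.of_forall fun ω => ?_)
        by_cases h : ω ∈ R <;> simp [h]
      _ = ∫ ω, X ω - X ω *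
          (μ[R.indicator (fun _ => (1 : ℝ)) | MeasurableSpace.comap X inferInstance]) ω ∂μ := by
        rw [integral_sub hXint hXR, hobs, integral_sub hXint hXp]
      _ = _ := by
        refine Eq.trans (integral_congr_ae ?_) htilt.symm
        filter_upwards [hmdm] with ω h
        simp only [h, Function.comp_apply]
        rw [mul_assoc, expit_mul_exp_neg]
        ring
  rw [key]
  field_simp
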